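/- arXiv:1405.1287 — 6 statements merged into one kernel-verified Lean document; each statement's English description precedes it below -/
import Mathlib

section
/- For every general program P, every FLP answer set of P is also an SFLP answer set of P; that is, FLP(P) ⊆ SFLP(P). -/
/-- A general rule: a finite set of atoms as (disjunctive) head,
and a generalized atom (a mapping from interpretations to truth values) as body. -/
structure GRule (B : Type*) where
  head : Finset B
  body : Set B → Prop

variable {B : Type*}

/-- `I ⊨ r`: whenever the body is true in `I`, some head atom is true in `I`. -/
def satRule (I : Set B) (r : GRule B) : Prop :=
  r.body I → (I ∩ ↑r.head).Nonempty

/-- `I ⊨ P`. -/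
def satProg (I : Set B) (P : Set (GRule B)) : Prop :=
  ∀ r ∈ P, satRule I r

/-- The FLP reduct `P^I`. -/
def reduct (P : Set (GRule B)) (I : Set B) : Set (GRule B) :=
  {r ∈ P | r.body I}

/-- `I ⊨_s P`: `I` is a supported model of `P`. -/
def suppModel (I : Set B) (P : Set (GRule B)) : Prop :=
  satProg I P ∧ ∀ a ∈ I, ∃ r ∈ P, r.body I ∧ I ∩ ↑r.head = {a}

/-- `I` is an FLP answer set of `P`. -/
def isFLP (I : Set B) (P : Set (GRule B)) : Prop :=
  satProg I P ∧ ∀ J : Set B, J ⊂ I → ¬ satProg J (reduct P I)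

/-- `I` is an SFLP answer set of `P`. -/
def isSFLP (I : Set B) (P : Set (GRule B)) : Prop :=
  suppModel I P ∧ ∀ J : Set B, J ⊂ I → ¬ suppModel J (reduct P I)

/-- For every general program P, FLP(P) ⊆ SFLP(P). -/
theorem stmt0 {B : Type*} (P : Set (GRule B)) :
    {I : Set B | isFLP I P} ⊆ {I : Set B | isSFLP I P} := by
  rintro I ⟨hI, hmin⟩
  refine ⟨⟨hI, fun a ha => ?_⟩, fun J hJ h => hmin J hJ h.1⟩
  have h := hmin (I \ {a})
    ⟨Set.diff_subset, fun hs => (hs ha).2 rfl⟩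
  unfold satProg satRule at h
  push Not at h
  obtain ⟨r, hr, _, he⟩ := h
  refine ⟨r, hr.1, hr.2, ?_⟩
  have key : ∀ x ∈ I ∩ ↑r.head, x = a := by
    intro x hx
    by_contra hne
    have : x ∈ (I \ {a}) ∩ (↑r.head : Set B) := ⟨⟨hx.1, hne⟩, hx.2⟩
    rw [he] at this
    exact this
  exact (Set.Nonempty.subset_singleton_iff (hI r hr.1 hr.2)).1 key
end

section
/- If P is a convex program then its FLP answer sets and its SFLP answer sets coincide: FLP(P) = SFLP(P). -/
variable {B : Type*}

/-- A generalized atom is convex if I ⊊ J ⊊ K, I ⊨ A and K ⊨ A imply J ⊨ A. -/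
def ConvexGA (A : Set B → Prop) : Prop :=
  ∀ I J K : Set B, I ⊂ J → J ⊂ K → A I → A K → A J

theorem chain_miss {B : Type*} (c : Set (Set B)) (hc : IsChain (· ⊆ ·) c) (hne : c.Nonempty)
    (F : Finset B) : (∀ h ∈ F, ∃ s ∈ c, h ∉ s) → ∃ s ∈ c, ∀ h ∈ F, h ∉ s := by
  classical
  induction F using Finset.induction_on with
  | empty =>
    intro _
    obtain ⟨s, hs⟩ := hne
    exact ⟨s, hs, by simp⟩
  | insert a F _ ih =>
    intro H
    obtain ⟨s, hs, hsF⟩ := ih (fun h hh => H h (Finset.mem_insert_of_mem hh))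
    obtain ⟨t, ht, hat⟩ := H a (Finset.mem_insert_self a F)
    rcases hc.total hs ht with hst | hts
    · refine ⟨s, hs, fun h hh => ?_⟩
      rcases Finset.mem_insert.1 hh with rfl | hh
      · exact fun hx => hat (hst hx)
      · exact hsF h hh
    · refine ⟨t, ht, fun h hh => ?_⟩
      rcases Finset.mem_insert.1 hh with rfl | hh
      · exact hat
      · exact fun hx => hsF h hh (hts hx)

theorem supp_of_min {B : Type*} (P : Set (GRule B)) (I : Set B)
    (hup : ∀ r ∈ P, ∀ J K : Set B, J ⊆ K → K ⊆ I → r.body J → r.body K)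
    (J : Set B) (hJI : J ⊆ I) (hJ : satProg J P)
    (hmin : ∀ K, K ⊂ J → ¬ satProg K P) : suppModel J P := by
  refine ⟨hJ, fun a ha => ?_⟩
  have hlt : J \ {a} ⊂ J :=
    ⟨Set.diff_subset, fun h => (h ha).2 rfl⟩
  have h1 := hmin _ hlt
  unfold satProg satRule at h1
  push Not at h1
  obtain ⟨r, hr, hb, hh⟩ := h1
  have hbJ := hup r hr _ _ hlt.1 hJI hb
  refine ⟨r, hr, hbJ, ?_⟩
  have hsub : ∀ x ∈ J ∩ ↑r.head, x = a := by
    intro x hx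
    by_contra hxa
    have : x ∈ J \ {a} ∩ ↑r.head := ⟨⟨hx.1, hxa⟩, hx.2⟩
    rw [hh] at this
    exact this
  exact Set.eq_singleton_iff_nonempty_unique_mem.2 ⟨hJ r hr hbJ, hsub⟩

/-- If P is a convex program then FLP(P) = SFLP(P). -/
theorem stmt2 {B : Type*} (P : Set (GRule B)) (hconv : ∀ r ∈ P, ConvexGA r.body) :
    {I : Set B | isFLP I P} = {I : Set B | isSFLP I P} := by
  have hup : ∀ I : Set B, ∀ r ∈ reduct P I, ∀ J K : Set B, J ⊆ K → K ⊆ I →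
      r.body J → r.body K := by
    intro I r hr J K hJK hKI hb
    rcases eq_or_ssubset_of_subset hJK with rfl | h1
    · exact hb
    rcases eq_or_ssubset_of_subset hKI with rfl | h2
    · exact hr.2
    exact hconv r hr.1 J K I h1 h2 hb hr.2
  ext I
  constructor
  · rintro ⟨hI, hmin⟩
    have hs := supp_of_min (reduct P I) I (hup I) I subset_rfl (fun r hr => hI r hr.1) hmin
    refine ⟨⟨hI, fun a ha => ?_⟩, fun J hJ h => hmin J hJ h.1⟩
    obtain ⟨r, hr, h⟩ := hs.2 a ha
    exact ⟨r, hr.1, h⟩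
  · rintro ⟨hI, hmin⟩
    refine ⟨hI.1, fun J hJ hsat => ?_⟩
    obtain ⟨M, hMJ, hM⟩ := zorn_superset_nonempty
      {K : Set B | K ⊆ I ∧ satProg K (reduct P I)} (by
        intro c hcS hc hne
        refine ⟨⋂₀ c, ⟨?_, ?_⟩, fun s hs => Set.sInter_subset_of_mem hs⟩
        · obtain ⟨s, hs⟩ := hne
          exact (Set.sInter_subset_of_mem hs).trans (hcS hs).1
        · intro r hr hb
          by_contra hcon
          obtain ⟨s, hs, hsH⟩ := chain_miss c hc hne r.head (by
            intro h hh
            by_contra hx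
            push Not at hx
            exact hcon ⟨h, hx, hh⟩)
          obtain ⟨x, hx⟩ := (hcS hs).2 r hr
            (hup I r hr _ _ (Set.sInter_subset_of_mem hs) (hcS hs).1 hb)
          exact hsH x hx.2 hx.1) J ⟨hJ.1, hsat⟩
    refine hmin M (lt_of_le_of_lt hMJ hJ) (supp_of_min (reduct P I) I (hup I) M hM.prop.1 hM.prop.2 ?_)
    intro K hK hKs
    exact hK.2 (hM.le_of_le ⟨hK.1.trans hM.prop.1, hKs⟩ hK.1)
end

section
/- Let P be a convex program, I an interpretation, and J ⊆ I a subset-minimal model of the FLP reduct P^I (i.e., J ⊨ P^I and no K ⊊ J satisfies K ⊨ P^I). Then J is a supported model of P^I, i.e., J ⊨_s P^I. -/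
variable {B : Type*}

/-- in a convex program, a subset-minimal model J ⊆ I of the
reduct P^I is a supported model of P^I. -/
theorem stmt3 {B : Type*} (P : Set (GRule B)) (hconv : ∀ r ∈ P, ConvexGA r.body)
    (I J : Set B) (hJI : J ⊆ I)
    (hJ : satProg J (reduct P I))
    (hmin : ∀ K : Set B, K ⊂ J → ¬ satProg K (reduct P I)) :
    suppModel J (reduct P I) := by
  refine ⟨hJ, fun a ha => ?_⟩
  have hK : J \ {a} ⊂ J :=
    ⟨Set.diff_subset, fun h => (h ha).2 rfl⟩
  have h := hmin _ hK
  simp only [satProg, satRule, not_forall] at h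
  obtain ⟨r, hr, hbK, hne⟩ := h
  have hbJ : r.body J := by
    rcases hJI.eq_or_ssubset with h | h
    · rw [h]; exact hr.2
    · exact hconv r hr.1 _ _ _ hK h hbK hr.2
  have hall : ∀ x, x ∈ J → x ∈ r.head → x = a := by
    intro x hx hxh
    by_contra hxa
    exact hne ⟨x, ⟨hx, hxa⟩, hxh⟩
  refine ⟨r, hr, hbJ, ?_⟩
  obtain ⟨x, hx, hxh⟩ := hJ r hr hbJ
  have hxa := hall x hx hxh
  subst hxa
  ext y
  constructor
  · rintro ⟨hy, hyh⟩
    exact hall y hy hyh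
  · intro hy
    have hy2 : y = x := hy
    subst hy2
    exact ⟨hx, hxh⟩
end

section
/- Every FLP answer set is a supported model: if I is an FLP answer set of a general program P, then I ⊨_s P. -/
variable {B : Type*}

/-- every FLP answer set of P is a supported model of P. -/
theorem stmt7 {B : Type*} (P : Set (GRule B)) (I : Set B)
    (h : isFLP I P) : suppModel I P := by
  refine ⟨h.1, fun a ha => ?_⟩
  by_contra hc
  push Not at hc
  refine h.2 (I \ {a}) ⟨Set.diff_subset, fun hs => (hs ha).2 rfl⟩ ?_
  intro r hr _
  by_contra hne
  apply hc r hr.1 hr.2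
  have key : ∀ y, y ∈ I ∩ ↑r.head → y = a := by
    intro y hy
    by_contra hya
    exact hne ⟨y, ⟨hy.1, hya⟩, hy.2⟩
  obtain ⟨x, hx⟩ := h.1 r hr.1 hr.2
  exact Set.eq_singleton_iff_unique_mem.2 ⟨key x hx ▸ hx, key⟩
end

section
/- Let P3 = {a ← A; b ← A; ← ~a; ← ~b}, where A is the generalized atom COUNT({a,b}) ≠ 1, and ← ~a (resp. ← ~b) is the rule with empty head and body the generalized atom true in I iff a ∉ I (resp. b ∉ I). Then {a,b} is the unique model of P3 among interpretations I ⊆ {a,b}, P3 has no FLP answer set (FLP(P3) = ∅), and SFLP(P3) = {{a,b}}. -/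
variable {B : Type*}

/-- for P3 = {a ← A; b ← A; ← ~a; ← ~b} with
A = COUNT({a,b}) ≠ 1: {a,b} is the unique model of P3 among I ⊆ {a,b},
FLP(P3) = ∅, and SFLP(P3) = {{a,b}}. -/
theorem stmt18 {B : Type*} (a b : B) (hab : a ≠ b)
    (A : Set B → Prop) (hA : ∀ I : Set B, A I ↔ (I ∩ {a, b}).ncard ≠ 1)
    (P : Set (GRule B))
    (hP : P = {⟨{a}, A⟩, ⟨{b}, A⟩,
               ⟨∅, fun I => a ∉ I⟩, ⟨∅, fun I => b ∉ I⟩}) :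
    (∀ I : Set B, I ⊆ {a, b} → (satProg I P ↔ I = {a, b})) ∧
    (∀ I : Set B, ¬ isFLP I P) ∧
    (∀ I : Set B, isSFLP I P ↔ I = {a, b}) := by
  have hA' : ∀ I : Set B, A I ↔ (a ∈ I ↔ b ∈ I) := by
    intro I
    rw [hA]
    by_cases h1 : a ∈ I <;> by_cases h2 : b ∈ I
    · have : I ∩ {a, b} = {a, b} := by ext x; simp; rintro (rfl | rfl) <;> assumption
      rw [this, Set.ncard_pair hab]; simp [h1, h2]
    · have : I ∩ {a, b} = {a} := by ext x; simp; grind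
      rw [this, Set.ncard_singleton]; simp [h1, h2]
    · have : I ∩ {a, b} = {b} := by ext x; simp; grind
      rw [this, Set.ncard_singleton]; simp [h1, h2]
    · have : I ∩ {a, b} = ∅ := by ext x; simp; grind
      rw [this, Set.ncard_empty]; simp [h1, h2]
  have hS : ∀ I : Set B, satProg I P ↔ (a ∈ I ∧ b ∈ I) := by
    intro I
    subst hP
    simp [satProg, satRule, hA']
    grind
  have hR : ∀ I : Set B, a ∈ I → b ∈ I → reduct P I = {⟨{a}, A⟩, ⟨{b}, A⟩} := by
    intro I h1 h2
    have h3 : A I := by rw [hA']; simp [h1, h2]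
    subst hP
    ext r
    simp only [reduct, Set.mem_ofPred_eq, Set.mem_insert_iff, Set.mem_singleton_iff]
    constructor
    · rintro ⟨rfl | rfl | rfl | rfl, h⟩
      · simp
      · simp
      · exact absurd h1 h
      · exact absurd h2 h
    · rintro (rfl | rfl) <;> simp [h3]
  refine ⟨?_, ?_, ?_⟩
  · intro I hI
    rw [hS]
    constructor
    · rintro ⟨h1, h2⟩
      apply hI.antisymm
      rintro x (rfl | rfl) <;> assumption
    · rintro rfl; simp
  · rintro I ⟨h, hm⟩
    obtain ⟨h1, h2⟩ := (hS I).1 h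
    have hb : b ∉ ({a} : Set B) := fun h => hab h.symm
    apply hm {a} ⟨by simpa using h1, fun h => hb (h h2)⟩
    rw [hR I h1 h2]
    have hn : ¬ A {a} := by rw [hA']; simp [hab.symm]
    rintro r (rfl | rfl) hr <;> exact absurd hr hn
  · intro I
    constructor
    · rintro ⟨⟨h, hs⟩, -⟩
      obtain ⟨h1, h2⟩ := (hS I).1 h
      ext x
      constructor
      · intro hx
        obtain ⟨r, hr, -, he⟩ := hs x hx
        have hxr : x ∈ I ∩ (r.head : Set B) := by rw [he]; rfl
        subst hP
        rcases hr with rfl | rfl | rfl | rfl <;> simp at hxr <;> simp [hxr]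
      · rintro (rfl | rfl) <;> assumption
    · rintro rfl
      have hAab : A {a, b} := by rw [hA']; simp
      refine ⟨⟨(hS _).2 (by simp), ?_⟩, ?_⟩
      · rintro x (rfl | rfl)
        · exact ⟨⟨{x}, A⟩, by simp [hP], hAab, by ext; simp⟩
        · exact ⟨⟨{x}, A⟩, by simp [hP], hAab, by ext; simp⟩
      · rintro J hJ ⟨hj, hs⟩
        rw [hR _ (by simp) (by simp)] at hj hs
        have hn : ¬ A J := by
          intro hAJ
          have ha : a ∈ J := by simpa using hj ⟨{a}, A⟩ (by simp) hAJ
          have hb : b ∈ J := by simpa using hj ⟨{b}, A⟩ (by simp) hAJ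
          apply hJ.2
          rintro x (rfl | rfl) <;> assumption
        have hne : ∃ x, x ∈ J := by
          by_contra hc
          push Not at hc
          exact hn ((hA' J).2 (by simp [hc]))
        obtain ⟨x, hx⟩ := hne
        obtain ⟨r, hr, hb, -⟩ := hs x hx
        rcases hr with rfl | rfl <;> exact hn hb
end

section
/- Let P4 = {a ← A; b ← A; a ∨ b ←}, where A is the generalized atom COUNT({a,b}) ≠ 1 and a ∨ b ← is the rule with head {a,b} and body the generalized atom true in every interpretation. Then FLP(P4) = SFLP(P4) = {{a}, {b}}; moreover {a,b} is a supported model of P4 that is not an SFLP answer set of P4. -/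
variable {B : Type*}

/-- for P4 = {a ← A; b ← A; a ∨ b ←} with
A = COUNT({a,b}) ≠ 1: FLP(P4) = SFLP(P4) = {{a},{b}}, and {a,b} is a
supported model of P4 which is not an SFLP answer set of P4. -/
theorem stmt19 {B : Type*} [DecidableEq B] (a b : B) (hab : a ≠ b)
    (A : Set B → Prop) (hA : ∀ I : Set B, A I ↔ (I ∩ {a, b}).ncard ≠ 1)
    (P : Set (GRule B))
    (hP : P = {⟨{a}, A⟩, ⟨{b}, A⟩, ⟨{a, b}, fun _ => True⟩}) :
    (∀ I : Set B, isFLP I P ↔ (I = {a} ∨ I = {b})) ∧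
    (∀ I : Set B, isSFLP I P ↔ (I = {a} ∨ I = {b})) ∧
    suppModel {a, b} P ∧ ¬ isSFLP {a, b} P := by
  have hA' : ∀ I : Set B, A I ↔ (a ∈ I ↔ b ∈ I) := by
    intro I
    rw [hA]
    by_cases h1 : a ∈ I <;> by_cases h2 : b ∈ I
    · have : I ∩ {a, b} = {a, b} := by ext x; simp; rintro (rfl | rfl) <;> assumption
      rw [this, Set.ncard_pair hab]; simp [h1, h2]
    · have : I ∩ {a, b} = {a} := by ext x; simp; grind
      rw [this]; simp [h1, h2]
    · have : I ∩ {a, b} = {b} := by ext x; simp; grind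
      rw [this]; simp [h1, h2]
    · have : I ∩ {a, b} = ∅ := by ext x; simp; grind
      rw [this]; simp [h1, h2]
  have hsat : ∀ J : Set B, satProg J P ↔ (a ∈ J ∨ b ∈ J) := by
    intro J
    subst hP
    simp [satProg, satRule, hA', Set.Nonempty]
    grind
  have hred : ∀ I J : Set B, satProg J (reduct P I) ↔ (a ∈ J ∨ b ∈ J) := by
    intro I J
    subst hP
    simp [satProg, satRule, reduct, hA', Set.Nonempty]
    grind
  have hm : (⟨{a, b}, fun _ => True⟩ : GRule B) ∈ P := by subst hP; simp
  have hmr : ∀ I, (⟨{a, b}, fun _ => True⟩ : GRule B) ∈ reduct P I :=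
    fun I => ⟨hm, trivial⟩
  have hs : ∀ x, x = a ∨ x = b → suppModel {x} P := by
    intro x hx
    refine ⟨(hsat _).2 (by grind), ?_⟩
    intro y hy
    refine ⟨_, hm, trivial, ?_⟩
    ext z; simp at *; grind
  have hsr : ∀ I x, x = a ∨ x = b → suppModel {x} (reduct P I) := by
    intro I x hx
    refine ⟨(hred _ _).2 (by grind), ?_⟩
    intro y hy
    refine ⟨_, hmr I, trivial, ?_⟩
    ext z; simp at *; grind
  have hmin : ∀ x, x = a ∨ x = b → ∀ I J : Set B, J ⊂ {x} → ¬ satProg J (reduct P I) := by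
    intro x hx I J hJ
    rw [Set.ssubset_singleton_iff] at hJ
    subst hJ
    rw [hred]; simp
  have key : ∀ I : Set B, (a ∈ I ∨ b ∈ I) →
      (∀ J : Set B, J ⊂ I → ¬ suppModel J (reduct P I)) → I = {a} ∨ I = {b} := by
    intro I h hJ
    rcases h with h | h
    · left
      by_contra hne
      exact hJ {a} ((Set.singleton_subset_iff.2 h).ssubset_of_ne (Ne.symm hne)) (hsr I a (.inl rfl))
    · right
      by_contra hne
      exact hJ {b} ((Set.singleton_subset_iff.2 h).ssubset_of_ne (Ne.symm hne)) (hsr I b (.inr rfl))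
  have hSF : ∀ I : Set B, isSFLP I P ↔ (I = {a} ∨ I = {b}) := by
    intro I
    constructor
    · rintro ⟨h1, h2⟩
      exact key I ((hsat I).1 h1.1) h2
    · rintro (rfl | rfl)
      · exact ⟨hs a (.inl rfl), fun J hJ h => hmin a (.inl rfl) _ J hJ h.1⟩
      · exact ⟨hs b (.inr rfl), fun J hJ h => hmin b (.inr rfl) _ J hJ h.1⟩
  refine ⟨?_, hSF, ?_, ?_⟩
  · intro I
    constructor
    · rintro ⟨h1, h2⟩
      exact key I ((hsat I).1 h1) (fun J hJ h => h2 J hJ h.1)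
    · rintro (rfl | rfl)
      · exact ⟨(hs a (.inl rfl)).1, hmin a (.inl rfl) _⟩
      · exact ⟨(hs b (.inr rfl)).1, hmin b (.inr rfl) _⟩
  · refine ⟨(hsat _).2 (by simp), ?_⟩
    have hAab : A {a, b} := by rw [hA']; simp
    intro y hy
    rcases hy with rfl | hy
    · exact ⟨⟨{y}, A⟩, by subst hP; simp, hAab, by ext z; simp⟩
    · have hy : y = b := hy
      subst hy
      exact ⟨⟨{y}, A⟩, by subst hP; simp, hAab, by ext z; simp⟩
  · rw [hSF]
    rintro (h | h)
    · have : b ∈ ({a} : Set B) := h ▸ (by simp)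
      exact hab (Set.mem_singleton_iff.1 this).symm
    · have : a ∈ ({b} : Set B) := h ▸ (by simp)
      exact hab (Set.mem_singleton_iff.1 this)
end
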